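/- arXiv:1509.01449 — 2 statements merged into one kernel-verified Lean document; each statement's English description precedes it below -/
import Mathlib

section
/- Let m ≥ 1 and j ≥ 0 be integers, and let u be a harmonic homogeneous polynomial of degree j in the real variables x_0,…,x_m (i.e. Δu = 0). Then for every integer k ≥ 1, Δ(κ^k · u) = 2k(m+2j+2k−1) · κ^{k−1} · u. -/
open MvPolynomial

/-- The polynomial Laplacian `Δv = ∑ i, ∂²v/∂x_i²`. -/
noncomputable def polyLap (m : ℕ) (v : MvPolynomial (Fin (m + 1)) ℝ) :
    MvPolynomial (Fin (m + 1)) ℝ :=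
  ∑ i : Fin (m + 1), pderiv i (pderiv i v)

/-- The polynomial `κ = x_0² + ⋯ + x_m²`. -/
noncomputable def kappaPoly (m : ℕ) : MvPolynomial (Fin (m + 1)) ℝ :=
  ∑ i : Fin (m + 1), X i ^ 2

theorem pderiv_kappaPoly (m : ℕ) (i : Fin (m + 1)) :
    pderiv i (kappaPoly m) = 2 * X i := by
  classical
  simp [kappaPoly, pderiv_X, Pi.single_apply]

theorem pderiv_kappaPoly_pow (m n : ℕ) (i : Fin (m + 1)) :
    pderiv i (kappaPoly m ^ n) =
      2 * ((n : MvPolynomial (Fin (m + 1)) ℝ) * kappaPoly m ^ (n - 1)) * X i := by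
  rw [pderiv_pow, pderiv_kappaPoly]
  ring

theorem pderiv_pderiv_kappaPoly_pow_mul (m n : ℕ) (u : MvPolynomial (Fin (m + 1)) ℝ)
    (i : Fin (m + 1)) :
    pderiv i (pderiv i (kappaPoly m ^ (n + 1) * u)) =
      4 * ((n : MvPolynomial (Fin (m + 1)) ℝ) + 1) *
        ((n : MvPolynomial (Fin (m + 1)) ℝ) * kappaPoly m ^ (n - 1)) * u * X i ^ 2 +
        2 * ((n : MvPolynomial (Fin (m + 1)) ℝ) + 1) * kappaPoly m ^ n * u +
        4 * ((n : MvPolynomial (Fin (m + 1)) ℝ) + 1) * kappaPoly m ^ n * (X i * pderiv i u) +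
        kappaPoly m ^ (n + 1) * pderiv i (pderiv i u) := by
  have hC : (C 2 : MvPolynomial (Fin (m + 1)) ℝ) = 2 := map_ofNat C 2
  have h : pderiv i (kappaPoly m ^ (n + 1) * u) =
      C (2 * ((n : ℝ) + 1)) * (kappaPoly m ^ n * (X i * u)) +
        kappaPoly m ^ (n + 1) * pderiv i u := by
    rw [pderiv_mul, pderiv_kappaPoly_pow]
    simp [hC]
    ring
  rw [h, map_add, pderiv_C_mul]
  simp only [pderiv_mul, pderiv_kappaPoly_pow, pderiv_X_self]
  simp [hC]
  ring

theorem stmt_0 (m j k : ℕ) (hm : 1 ≤ m) (hk : 1 ≤ k)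
    (u : MvPolynomial (Fin (m + 1)) ℝ) (hu : u.IsHomogeneous j)
    (hharm : polyLap m u = 0) :
    polyLap m (kappaPoly m ^ k * u) =
      C ((2 * k * (m + 2 * j + 2 * k - 1) : ℕ) : ℝ) * (kappaPoly m ^ (k - 1) * u) := by
  obtain ⟨n, rfl⟩ : ∃ n, k = n + 1 := ⟨k - 1, by omega⟩
  have hsub : m + 2 * j + 2 * (n + 1) - 1 = m + 2 * j + 2 * n + 1 := by omega
  have hpow : (n : MvPolynomial (Fin (m + 1)) ℝ) * kappaPoly m ^ (n - 1) * kappaPoly m =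
      n * kappaPoly m ^ n := by
    cases n with
    | zero => simp
    | succ n => rw [Nat.add_sub_cancel, mul_assoc, pow_succ]
  have heuler := hu.sum_X_mul_pderiv
  have hsq : ∑ i : Fin (m + 1), (X i : MvPolynomial (Fin (m + 1)) ℝ) ^ 2 = kappaPoly m := rfl
  have hlap : ∑ i : Fin (m + 1), pderiv i (pderiv i u) = 0 := hharm
  rw [nsmul_eq_mul] at heuler
  rw [polyLap, hsub, Nat.add_sub_cancel]
  simp only [pderiv_pderiv_kappaPoly_pow_mul, Finset.sum_add_distrib, ← Finset.mul_sum, heuler,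
    hsq, hlap, Finset.sum_const, Finset.card_univ, Fintype.card_fin, nsmul_eq_mul, map_natCast]
  push_cast
  linear_combination 4 * ((n : MvPolynomial (Fin (m + 1)) ℝ) + 1) * u * hpow
end

section
/- For integers m ≥ 2 set A_m = (2√2 / Γ(m/2)) · ((m−1)/(2e))^{(m−1)/2}. Then the sequence (A_m)_{m≥2} is strictly decreasing, lim_{m→∞} A_m = 2/√π, and consequently 2/√π < A_m ≤ 2/√e for all m ≥ 2, with A_2 = 2/√e. -/
/-- `A_m = (2√2 / Γ(m/2)) ((m-1)/(2e))^{(m-1)/2}`. -/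
noncomputable def Aconst (m : ℕ) : ℝ :=
  2 * Real.sqrt 2 / Real.Gamma ((m : ℝ) / 2) *
    (((m : ℝ) - 1) / (2 * Real.exp 1)) ^ (((m : ℝ) - 1) / 2)

open Real Filter Topology

/-- Up to an additive constant, `log A_m` is the value of this function at `x = (m - 1) / 2`. -/
noncomputable def logAconst (x : ℝ) : ℝ :=
  x * log x - x - log (Gamma (x + 1 / 2))

lemma log_Gamma_add_one {x : ℝ} (hx : 0 < x) : log (Gamma (x + 1)) = log x + log (Gamma x) := by
  rw [Gamma_add_one hx.ne', log_mul hx.ne' (Gamma_pos_of_pos hx).ne']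

lemma log_Gamma_add_half_le {x : ℝ} (hx : 0 < x) :
    log (Gamma (x + 1 / 2)) ≤ 1 / 2 * log x + log (Gamma x) := by
  have h := convexOn_log_Gamma.2 (Set.mem_Ioi.2 hx) (Set.mem_Ioi.2 (add_pos hx one_pos))
    one_half_pos.le one_half_pos.le (add_halves 1)
  simp only [smul_eq_mul, Function.comp_apply] at h
  rw [log_Gamma_add_one hx, show 1 / 2 * x + 1 / 2 * (x + 1) = x + 1 / 2 by ring] at h
  linarith

lemma logAconst_add_one_sub {x : ℝ} (hx : 0 < x) :
    logAconst (x + 1) - logAconst x = (x + 1) * log (x + 1) - x * log x - 1 - log (x + 1 / 2) := by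
  have h := log_Gamma_add_one (x := x + 1 / 2) (by linarith)
  rw [add_right_comm] at h
  rw [logAconst, logAconst, h]
  ring

lemma one_div_add_half_lt_log {x : ℝ} (hx : 0 < x) :
    1 / (x + 1 / 2) < log (x + 1) - log x := by
  have h := lt_log_one_add_of_pos (x := 1 / x) (by positivity)
  rw [← log_div (by positivity) hx.ne']
  convert h using 1
  · field_simp
    ring
  · congr 1
    field_simp

lemma strictMonoOn_logAconst_step :
    StrictMonoOn (fun x : ℝ ↦ (x + 1) * log (x + 1) - x * log x - 1 - log (x + 1 / 2))
      (Set.Ioi 0) := by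
  have hderiv (x : ℝ) (hx : 0 < x) :
      HasDerivAt (fun x : ℝ ↦ (x + 1) * log (x + 1) - x * log x - 1 - log (x + 1 / 2))
        (log (x + 1) - log x - 1 / (x + 1 / 2)) x := by
    have h1 := (hasDerivAt_mul_log (x := x + 1) (by positivity)).comp_add_const x 1
    have h2 := hasDerivAt_mul_log hx.ne'
    have h3 := ((hasDerivAt_id x).add_const (1 / 2)).log (by simp only [id]; positivity)
    refine (((h1.sub h2).sub_const 1).sub h3).congr_deriv ?_
    simp only [id]
    ring
  refine strictMonoOn_of_deriv_pos (convex_Ioi 0)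
    (fun x hx ↦ (hderiv x hx).continuousAt.continuousWithinAt) fun x hx ↦ ?_
  rw [interior_Ioi] at hx
  rw [(hderiv x hx).deriv]
  linarith [one_div_add_half_lt_log hx]

lemma log_one_add_half_div {x : ℝ} (hx : 0 < x) :
    log (1 + 1 / 2 / x) = log (x + 1 / 2) - log x := by
  rw [← log_div (by positivity) hx.ne']
  congr 1
  field_simp

lemma tendsto_log_one_add_half_div :
    Tendsto (fun x : ℝ ↦ log (1 + 1 / 2 / x)) atTop (𝓝 0) := by
  have h : Tendsto (fun x : ℝ ↦ 1 + 1 / 2 / x) atTop (𝓝 1) := by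
    simpa using! (tendsto_const_nhds (x := (1 : ℝ))).add
      (tendsto_const_nhds (x := (1 / 2 : ℝ)).div_atTop tendsto_id)
  simpa using h.log one_ne_zero

lemma tendsto_logAconst_sub_add_half :
    Tendsto (fun x ↦ logAconst x - logAconst (x + 1 / 2)) atTop (𝓝 0) := by
  have hw := tendsto_log_one_add_half_div
  have hxw := tendsto_mul_log_one_add_div_atTop (1 / 2)
  have hupper : Tendsto (fun x : ℝ ↦ 1 / 2 - x * log (1 + 1 / 2 / x)) atTop (𝓝 0) :=
    sub_self (1 / 2 : ℝ) ▸ hxw.const_sub (1 / 2)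
  have hlower : Tendsto (fun x : ℝ ↦ 1 / 2 - x * log (1 + 1 / 2 / x) - 1 / 2 * log (1 + 1 / 2 / x))
      atTop (𝓝 0) := by
    simpa only [mul_zero, sub_zero] using hupper.sub (hw.const_mul (1 / 2))
  refine tendsto_of_tendsto_of_tendsto_of_le_of_le' hlower hupper ?_ ?_ <;>
    filter_upwards [eventually_gt_atTop 0] with x hx <;>
    rw [log_one_add_half_div hx, logAconst, logAconst, add_assoc x, add_halves]
  · linarith [log_Gamma_add_half_le hx, log_Gamma_add_one hx]
  · have h := log_Gamma_add_half_le (x := x + 1 / 2) (by positivity)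
    rw [add_assoc x, add_halves] at h
    linarith

lemma logAconst_add_half_lt {x : ℝ} (hx : 0 < x) : logAconst (x + 1 / 2) < logAconst x := by
  have hstep (y : ℝ) (hy : 0 < y) :
      logAconst (y + 1) - logAconst (y + 1 + 1 / 2) < logAconst y - logAconst (y + 1 / 2) := by
    have h := strictMonoOn_logAconst_step (a := y) (b := y + 1 / 2) hy
      (Set.mem_Ioi.2 (by positivity)) (by linarith)
    beta_reduce at h
    rw [← logAconst_add_one_sub hy, ← logAconst_add_one_sub (by positivity)] at h
    rw [add_right_comm y 1]
    linarith
  have hanti : StrictAnti fun n : ℕ ↦ logAconst (x + n) - logAconst (x + n + 1 / 2) :=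
    strictAnti_nat_of_succ_lt fun n ↦ by
      push_cast
      rw [← add_assoc]
      exact hstep _ (by positivity)
  have hlim : Tendsto (fun n : ℕ ↦ logAconst (x + n) - logAconst (x + n + 1 / 2)) atTop (𝓝 0) :=
    tendsto_logAconst_sub_add_half.comp
      (tendsto_atTop_add_const_left _ x tendsto_natCast_atTop_atTop)
  have h := (hanti.antitone.le_of_tendsto hlim 1).trans_lt (hanti zero_lt_one)
  simp only [Nat.cast_zero, add_zero] at h
  linarith

lemma tendsto_logAconst_nat_add_half :
    Tendsto (fun n : ℕ ↦ logAconst (n + 1 / 2)) atTop (𝓝 (-log √π - 1 / 2 * log 2)) := by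
  have hcast := tendsto_natCast_atTop_atTop (R := ℝ)
  have hw := tendsto_log_one_add_half_div.comp hcast
  have hxw := (tendsto_mul_log_one_add_div_atTop (1 / 2)).comp hcast
  have hS := Stirling.tendsto_stirlingSeq_sqrt_pi.log (by positivity)
  have h := (hS.neg.sub_const (1 / 2 * log 2)).add
    ((hxw.add (hw.const_mul (1 / 2))).sub_const (1 / 2))
  rw [mul_zero, add_zero, sub_self, add_zero] at h
  refine h.congr' ?_
  filter_upwards [eventually_gt_atTop 0] with n hn
  have hn' : (0 : ℝ) < n := Nat.cast_pos.2 hn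
  simp only [Function.comp_apply]
  rw [Stirling.log_stirlingSeq_formula, log_one_add_half_div hn', logAconst, add_assoc (n : ℝ),
    add_halves, Gamma_nat_eq_factorial, log_mul two_ne_zero hn'.ne', log_div hn'.ne' (exp_ne_zero _),
    log_exp]
  ring

lemma Aconst_add_two (n : ℕ) :
    Aconst (n + 2) = 2 * √2 * exp (logAconst ((n + 1) / 2)) := by
  have hx : (0 : ℝ) < (n + 1) / 2 := by positivity
  have hG : 0 < Gamma (((n : ℝ) + 1) / 2 + 1 / 2) := Gamma_pos_of_pos (by positivity)
  rw [Aconst, logAconst, exp_sub, exp_log hG]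
  push_cast
  rw [show ((n : ℝ) + 2) / 2 = (n + 1) / 2 + 1 / 2 by ring,
    show ((n : ℝ) + 2 - 1) / 2 = (n + 1) / 2 by ring,
    show ((n : ℝ) + 2 - 1) / (2 * exp 1) = (n + 1) / 2 / exp 1 by rw [div_div]; ring,
    rpow_def_of_pos (by positivity), log_div hx.ne' (exp_ne_zero _), log_exp]
  ring_nf

lemma strictAnti_Aconst_add_two : StrictAnti fun n : ℕ ↦ Aconst (n + 2) := by
  refine strictAnti_nat_of_succ_lt fun n ↦ ?_
  rw [Aconst_add_two, Aconst_add_two]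
  have h := logAconst_add_half_lt (x := ((n : ℝ) + 1) / 2) (by positivity)
  rw [show ((n : ℝ) + 1) / 2 + 1 / 2 = ((n + 1 : ℕ) + 1) / 2 by push_cast; ring] at h
  gcongr

lemma tendsto_Aconst_add_two :
    Tendsto (fun n : ℕ ↦ Aconst (n + 2)) atTop (𝓝 (2 / √π)) := by
  rw [tendsto_iff_tendsto_subseq_of_antitone strictAnti_Aconst_add_two.antitone
    (tendsto_id.const_mul_atTop' (zero_lt_two' ℕ))]
  have h := (tendsto_logAconst_nat_add_half.rexp).const_mul (2 * √2)
  have hlim : 2 * √2 * exp (-log √π - 1 / 2 * log 2) = 2 / √π := by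
    rw [show (1 / 2 : ℝ) * log 2 = log √2 by rw [log_sqrt zero_le_two]; ring, exp_sub, exp_neg,
      exp_log (by positivity), exp_log (by positivity)]
    field_simp
  rw [hlim] at h
  refine h.congr fun n ↦ ?_
  rw [Function.comp_apply, Aconst_add_two]
  congr 3
  push_cast [id]
  ring

lemma Aconst_two : Aconst 2 = 2 / √(exp 1) := by
  rw [Aconst, Nat.cast_two, div_self two_ne_zero, Gamma_one, show (2 : ℝ) - 1 = 1 by norm_num,
    ← sqrt_eq_rpow, sqrt_div zero_le_one, sqrt_mul zero_le_two, sqrt_one]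
  field_simp

theorem stmt_19 :
    StrictAntiOn Aconst {m : ℕ | 2 ≤ m} ∧
      Filter.Tendsto Aconst Filter.atTop (nhds (2 / Real.sqrt Real.pi)) ∧
      (∀ m : ℕ, 2 ≤ m →
        2 / Real.sqrt Real.pi < Aconst m ∧ Aconst m ≤ 2 / Real.sqrt (Real.exp 1)) ∧
      Aconst 2 = 2 / Real.sqrt (Real.exp 1) := by
  have hanti := strictAnti_Aconst_add_two
  have hlim := tendsto_Aconst_add_two
  refine ⟨fun m hm k hk hmk ↦ ?_, (tendsto_add_atTop_iff_nat 2).1 hlim, fun m hm ↦ ?_, Aconst_two⟩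
  · obtain ⟨m, rfl⟩ := Nat.exists_eq_add_of_le' hm
    obtain ⟨k, rfl⟩ := Nat.exists_eq_add_of_le' hk
    exact hanti (by omega)
  · obtain ⟨m, rfl⟩ := Nat.exists_eq_add_of_le' hm
    refine ⟨(hanti.antitone.le_of_tendsto hlim (m + 1)).trans_lt (hanti m.lt_succ_self), ?_⟩
    rw [← Aconst_two]
    exact hanti.antitone m.zero_le
end
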